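/- The AFBS iterates λ^k converge weakly to a minimizer of h over K: there exists λ∞ ∈ K with h(λ∞) = inf_{λ∈K} h(λ) such that ⟨λ^k, y⟩ → ⟨λ∞, y⟩ as k → ∞ for every y ∈ H. -/

import Mathlib

open scoped RealInnerProductSpace

open Filter Topology

/-- A nonnegative sequence that decreases up to a summable error converges, and its decrements are
summable. -/
lemma summable_and_exists_tendsto_of_add_le_add {V b e : ℕ → ℝ} (hV : ∀ n, 0 ≤ V n)
    (hb : ∀ n, 0 ≤ b n) (he : ∀ n, 0 ≤ e n) (hes : Summable e)
    (hstep : ∀ n, V (n + 1) + b n ≤ V n + e n) :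
    Summable b ∧ ∃ l, Tendsto V atTop (𝓝 l) := by
  have hE : ∀ n, ∑ i ∈ Finset.range n, e i ≤ ∑' i, e i :=
    fun n => hes.sum_le_tsum _ fun i _ => he i
  constructor
  · have hsum : ∀ n, V n + ∑ i ∈ Finset.range n, b i ≤ V 0 + ∑ i ∈ Finset.range n, e i := by
      intro n
      induction n with
      | zero => simp
      | succ k ih =>
        rw [Finset.sum_range_succ, Finset.sum_range_succ]
        linarith [hstep k]
    exact summable_of_sum_range_le (c := V 0 + ∑' i, e i) hb
      fun n => by linarith [hsum n, hV n, hE n]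
  · have hanti : Antitone fun n => V n - ∑ i ∈ Finset.range n, e i := by
      refine antitone_nat_of_succ_le fun n => ?_
      rw [Finset.sum_range_succ]
      linarith [hstep n, hb n]
    have hbdd : BddBelow (Set.range fun n => V n - ∑ i ∈ Finset.range n, e i) := by
      refine ⟨-∑' i, e i, ?_⟩
      rintro _ ⟨n, rfl⟩
      simp only
      linarith [hV n, hE n]
    have hlim := (tendsto_atTop_ciInf hanti hbdd).add hes.hasSum.tendsto_sum_nat
    exact ⟨_, by simpa using hlim⟩

/-- Lyapunov argument for the function values of an inertial method: the weighted values are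
summable. -/
lemma summable_mul_of_lyapunov_step {a : ℝ} (ha : 2 < a) {φ U : ℕ → ℝ} (hφ : ∀ n, 0 ≤ φ n)
    (hU : ∀ n, 0 ≤ U n)
    (hstep : ∀ n : ℕ, ((n : ℝ) + 1 + a) ^ 2 * φ (n + 1) + U (n + 1) ≤
      (((n : ℝ) + 1 + a) ^ 2 - a * ((n : ℝ) + 1 + a)) * φ n + U n) :
    Summable fun n : ℕ => ((n : ℝ) + 1 + a) * φ n := by
  have hpos : ∀ n : ℕ, 0 < (n : ℝ) + 1 + a := fun n => by positivity
  have hs := (summable_and_exists_tendsto_of_add_le_add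
    (V := fun n : ℕ => ((n : ℝ) + a) ^ 2 * φ n + U n)
    (b := fun n : ℕ => (a - 2) * (((n : ℝ) + 1 + a) * φ n)) (e := fun _ => 0)
    (fun n => add_nonneg (mul_nonneg (sq_nonneg _) (hφ n)) (hU n))
    (fun n => mul_nonneg (by linarith) (mul_nonneg (hpos n).le (hφ n)))
    (fun _ => le_rfl) summable_zero fun n => ?_).1
  · exact (summable_mul_left_iff (by linarith : a - 2 ≠ 0)).1 hs
  · push_cast
    linarith [hstep n, hφ n]

/-- Summability of the weighted squared increments of an inertial method. -/
lemma summable_mul_of_energy_step {a : ℝ} (ha : 2 < a) {φ d : ℕ → ℝ} (hφ : ∀ n, 0 ≤ φ n)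
    (hd : ∀ n, 0 ≤ d n)
    (hstep : ∀ n : ℕ, φ (n + 1) + d (n + 1) ≤ φ n + ((n : ℝ) / ((n : ℝ) + 1 + a)) ^ 2 * d n)
    (hs : Summable fun n : ℕ => ((n : ℝ) + 1 + a) * φ n) :
    Summable fun n : ℕ => ((n : ℝ) + 1 + a) * d n := by
  have hpos : ∀ n : ℕ, 0 < (n : ℝ) + 1 + a := fun n => by positivity
  refine (summable_and_exists_tendsto_of_add_le_add
    (V := fun n : ℕ => ((n : ℝ) + a) ^ 2 * (φ n + d n))
    (e := fun n : ℕ => 2 * (((n : ℝ) + 1 + a) * φ n))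
    (fun n => mul_nonneg (sq_nonneg _) (add_nonneg (hφ n) (hd n)))
    (fun n => mul_nonneg (hpos n).le (hd n))
    (fun n => mul_nonneg zero_le_two (mul_nonneg (hpos n).le (hφ n)))
    (hs.mul_left 2) fun n => ?_).1
  have h1 := mul_le_mul_of_nonneg_left (hstep n) (sq_nonneg ((n : ℝ) + 1 + a))
  have h2 : ((n : ℝ) + 1 + a) ^ 2 * (φ n + ((n : ℝ) / ((n : ℝ) + 1 + a)) ^ 2 * d n) =
      ((n : ℝ) + 1 + a) ^ 2 * φ n + (n : ℝ) ^ 2 * d n := by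
    have := (hpos n).ne'
    field_simp
  rw [h2] at h1
  have hn : (0 : ℝ) ≤ n := n.cast_nonneg
  have h3 : (n : ℝ) ^ 2 + ((n : ℝ) + 1 + a) ≤ ((n : ℝ) + a) ^ 2 := by nlinarith
  have h4 := mul_le_mul_of_nonneg_right h3 (hd n)
  push_cast
  linarith [hφ n]

/-- A nonnegative sequence satisfying an inertial recursion with summable weighted errors
converges. -/
lemma exists_tendsto_of_inertial_step {a : ℝ} (ha : 2 < a) {s d : ℕ → ℝ} (hs : ∀ n, 0 ≤ s n)
    (hd : ∀ n, 0 ≤ d n)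
    (hstep : ∀ n : ℕ, s (n + 2) - s (n + 1) ≤
      (n : ℝ) / ((n : ℝ) + 1 + a) * (s (n + 1) - s n) + 2 * d n)
    (hsum : Summable fun n : ℕ => ((n : ℝ) + 1 + a) * d n) :
    ∃ l, Tendsto s atTop (𝓝 l) := by
  have hpos : ∀ n : ℕ, 0 < (n : ℝ) + 1 + a := fun n => by positivity
  let θ : ℕ → ℝ := fun n => max 0 (s (n + 1) - s n)
  have hθ : ∀ n, 0 ≤ θ n := fun n => le_max_left _ _
  have hθstep : ∀ n : ℕ, ((n : ℝ) + 1 + a) * θ (n + 1) ≤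
      n * θ n + 2 * (((n : ℝ) + 1 + a) * d n) := by
    intro n
    have hn : (0 : ℝ) ≤ n := n.cast_nonneg
    have h1 : θ (n + 1) ≤ (n : ℝ) / ((n : ℝ) + 1 + a) * θ n + 2 * d n := by
      have hα : 0 ≤ (n : ℝ) / ((n : ℝ) + 1 + a) := div_nonneg hn (hpos n).le
      refine max_le (add_nonneg (mul_nonneg hα (hθ n)) (by linarith [hd n])) ?_
      exact (hstep n).trans (by gcongr; exact le_max_right _ _)
    have h2 := mul_le_mul_of_nonneg_left h1 (hpos n).le
    refine h2.trans_eq ?_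
    have := (hpos n).ne'
    field_simp
  have hθsum : Summable θ := by
    have := (summable_and_exists_tendsto_of_add_le_add
      (V := fun n : ℕ => ((n : ℝ) + a) * θ n) (b := fun n => a * θ n)
      (e := fun n : ℕ => 2 * (((n : ℝ) + 1 + a) * d n))
      (fun n => mul_nonneg (by positivity) (hθ n))
      (fun n => mul_nonneg (by linarith) (hθ n))
      (fun n => mul_nonneg zero_le_two (mul_nonneg (hpos n).le (hd n)))
      (hsum.mul_left 2) fun n => ?_).1
    · exact (summable_mul_left_iff (by linarith : a ≠ 0)).1 this
    · push_cast
      linarith [hθstep n]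
  refine (summable_and_exists_tendsto_of_add_le_add (b := fun _ => 0) hs (fun _ => le_rfl) hθ
    hθsum fun n => ?_).2
  linarith [le_max_right 0 (s (n + 1) - s n)]

section Hilbert

variable {H : Type*} [NormedAddCommGroup H] [InnerProductSpace ℝ H]

/-- Along an ultrafilter, every norm-bounded family in a Hilbert space converges weakly. -/
lemma Ultrafilter.exists_tendsto_inner_of_norm_le [CompleteSpace H] {ι : Type*} {x : ι → H} {R : ℝ}
    (hx : ∀ i, ‖x i‖ ≤ R) (U : Ultrafilter ι) :
    ∃ p : H, ∀ y, Tendsto (fun i => ⟪x i, y⟫) U (𝓝 ⟪p, y⟫) := by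
  let f : ι → WeakDual ℝ H := fun i => StrongDual.toWeakDual (InnerProductSpace.toDual ℝ H (x i))
  have hmem : ∀ i, f i ∈ WeakDual.toStrongDual ⁻¹'
      Metric.closedBall (0 : StrongDual ℝ H) R := by
    intro i
    have : ‖InnerProductSpace.toDual ℝ H (x i)‖ ≤ R := by simpa using hx i
    simpa [f] using this
  obtain ⟨ξ, -, hξ⟩ := isCompact_iff_ultrafilter_le_nhds.1
    (WeakDual.isCompact_closedBall (0 : StrongDual ℝ H) R) (U.map f)
    (le_principal_iff.2 (mem_map.2 (Eventually.of_forall hmem)))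
  refine ⟨(InnerProductSpace.toDual ℝ H).symm (WeakDual.toStrongDual ξ), fun y => ?_⟩
  rw [InnerProductSpace.toDual_symm_apply]
  exact tendsto_iff_forall_eval_tendsto_topDualPairing.1 hξ y

/-- **Opial's lemma**: if the distance from `x n` to each point of `S` converges and every weak
cluster point of `x` lies in `S`, then `x` converges weakly to a point of `S`. -/
lemma exists_tendsto_inner_of_tendsto_norm_sub_sq [CompleteSpace H] {x : ℕ → H} {S : Set H}
    (hS : S.Nonempty)
    (hdist : ∀ m ∈ S, ∃ l, Tendsto (fun n => ‖x n - m‖ ^ 2) atTop (𝓝 l))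
    (hcluster : ∀ U : Ultrafilter ℕ, (U : Filter ℕ) ≤ atTop → ∀ p,
      (∀ y, Tendsto (fun n => ⟪x n, y⟫) U (𝓝 ⟪p, y⟫)) → p ∈ S) :
    ∃ p ∈ S, ∀ y, Tendsto (fun n => ⟪x n, y⟫) atTop (𝓝 ⟪p, y⟫) := by
  obtain ⟨R, hR⟩ : ∃ R, ∀ n, ‖x n‖ ≤ R := by
    obtain ⟨m, hm⟩ := hS
    obtain ⟨l, hl⟩ := hdist m hm
    obtain ⟨C, hC⟩ := hl.bddAbove_range
    refine ⟨(C + 1) + ‖m‖, fun n => ?_⟩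
    have h1 : ‖x n - m‖ ^ 2 ≤ C := hC ⟨n, rfl⟩
    have h2 : ‖x n‖ ≤ ‖x n - m‖ + ‖m‖ := by simpa using norm_add_le (x n - m) m
    nlinarith [sq_nonneg (‖x n - m‖ - 1), norm_nonneg (x n - m)]
  have hex := fun U : Ultrafilter ℕ => U.exists_tendsto_inner_of_norm_le hR
  have huniq : ∀ U V : Ultrafilter ℕ, (U : Filter ℕ) ≤ atTop → (V : Filter ℕ) ≤ atTop → ∀ p q,
      (∀ y, Tendsto (fun n => ⟪x n, y⟫) U (𝓝 ⟪p, y⟫)) →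
      (∀ y, Tendsto (fun n => ⟪x n, y⟫) V (𝓝 ⟪q, y⟫)) → p = q := by
    intro U V hU hV p q hp hq
    obtain ⟨l, hl⟩ := hdist p (hcluster U hU p hp)
    obtain ⟨l', hl'⟩ := hdist q (hcluster V hV q hq)
    have hinner : Tendsto (fun n => ⟪x n, p - q⟫) atTop
        (𝓝 ((l' - l - ‖q‖ ^ 2 + ‖p‖ ^ 2) / 2)) := by
      refine ((((hl'.sub hl).sub_const (‖q‖ ^ 2)).add_const (‖p‖ ^ 2)).div_const 2).congr
        fun n => ?_
      rw [norm_sub_sq_real, norm_sub_sq_real, inner_sub_right]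
      ring
    have h1 := tendsto_nhds_unique (hp (p - q)) (hinner.mono_left hU)
    have h2 := tendsto_nhds_unique (hq (p - q)) (hinner.mono_left hV)
    rw [← sub_eq_zero, ← inner_self_eq_zero (𝕜 := ℝ), inner_sub_left, h1, h2, sub_self]
  obtain ⟨p, hp⟩ := hex (Ultrafilter.of atTop)
  have hle := Ultrafilter.of_le (atTop : Filter ℕ)
  refine ⟨p, hcluster _ hle p hp, fun y => ?_⟩
  refine (tendsto_iff_ultrafilter _ _ _).2 fun U hU => ?_
  obtain ⟨q, hq⟩ := hex U
  rw [huniq _ U hle hU p q hp hq]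
  exact hq y

/-- The variational inequality characterizing nearest points of a convex set. -/
lemma Convex.inner_sub_le_zero_of_forall_norm_le {K : Set H} (hK : Convex ℝ K) {u v : H}
    (hv : v ∈ K) (hmin : ∀ z ∈ K, ‖u - v‖ ≤ ‖u - z‖) {z : H} (hz : z ∈ K) :
    ⟪u - v, z - v⟫ ≤ 0 := by
  have : Nonempty K := ⟨⟨v, hv⟩⟩
  refine (norm_eq_iInf_iff_real_inner_le_zero hK hv).1 (le_antisymm ?_ ?_) z hz
  · exact le_ciInf fun w => hmin w w.2
  · exact ciInf_le (f := fun w : K => ‖u - w‖)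
      ⟨0, by rintro _ ⟨w, rfl⟩; exact norm_nonneg _⟩ ⟨v, hv⟩

variable [CompleteSpace H]

lemma HasGradientAt.hasDerivAt_comp_add_smul {h : H → ℝ} {g' x v : H} {t : ℝ}
    (hg : HasGradientAt h g' (x + t • v)) :
    HasDerivAt (fun s : ℝ => h (x + s • v)) ⟪g', v⟫ t := by
  have hline : HasDerivAt (fun s : ℝ => x + s • v) v t := by
    simpa using ((hasDerivAt_id t).smul_const v).const_add x
  exact (hg.hasFDerivAt.comp_hasDerivAt t hline).congr_deriv (by simp)

lemma ConvexOn.add_inner_le_of_hasGradientAt {h : H → ℝ} (hconv : ConvexOn ℝ Set.univ h)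
    {g' x : H} (hg : HasGradientAt h g' x) (y : H) : h x + ⟪g', y - x⟫ ≤ h y := by
  have hc : ConvexOn ℝ Set.univ fun s : ℝ => h (x + s • (y - x)) := by
    have := hconv.comp_affineMap (AffineMap.lineMap (k := ℝ) x y)
    refine this.congr fun s _ => ?_
    simp [AffineMap.lineMap_apply, add_comm]
  have hd : HasDerivAt (fun s : ℝ => h (x + s • (y - x))) ⟪g', y - x⟫ 0 :=
    HasGradientAt.hasDerivAt_comp_add_smul (by simpa using hg)
  have := hc.le_slope_of_hasDerivAt (Set.mem_univ 0) (Set.mem_univ 1) one_pos hd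
  simp [slope_def_field] at this
  linarith

/-- The **descent lemma** for functions with Lipschitz gradient. -/
lemma le_add_inner_add_of_lipschitz_gradient {h : H → ℝ} {g : H → H}
    (hgrad : ∀ x, HasGradientAt h (g x) x) {L : ℝ}
    (hLip : ∀ x y, ‖g x - g y‖ ≤ L * ‖x - y‖) (x y : H) :
    h y ≤ h x + ⟪g x, y - x⟫ + L / 2 * ‖y - x‖ ^ 2 := by
  set v := y - x with hv
  let ψ : ℝ → ℝ := fun t => h (x + t • v) - t * ⟪g x, v⟫ - L / 2 * ‖v‖ ^ 2 * t ^ 2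
  have hψ : ∀ t, HasDerivAt ψ (⟪g (x + t • v), v⟫ - ⟪g x, v⟫ - L * ‖v‖ ^ 2 * t) t := by
    intro t
    have h1 := (hgrad (x + t • v)).hasDerivAt_comp_add_smul
    have h2 := (hasDerivAt_id t).mul_const ⟪g x, v⟫
    have h3 := ((hasDerivAt_id t).pow 2).const_mul (L / 2 * ‖v‖ ^ 2)
    refine ((h1.sub h2).sub h3).congr_deriv ?_
    simp
    ring
  have hanti : AntitoneOn ψ (Set.Icc 0 1) := by
    refine antitoneOn_of_deriv_nonpos (convex_Icc 0 1)
      (fun t _ => (hψ t).continuousAt.continuousWithinAt)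
      (fun t _ => (hψ t).differentiableAt.differentiableWithinAt) fun t ht => ?_
    rw [interior_Icc] at ht
    rw [(hψ t).deriv, ← inner_sub_left]
    have h1 := real_inner_le_norm (g (x + t • v) - g x) v
    have h2 := hLip (x + t • v) x
    rw [add_sub_cancel_left, norm_smul, Real.norm_of_nonneg ht.1.le] at h2
    nlinarith [norm_nonneg v]
  have := hanti (Set.left_mem_Icc.2 zero_le_one) (Set.right_mem_Icc.2 zero_le_one) zero_le_one
  simp [ψ, hv] at this
  linarith

/-- The fundamental inequality for one projected gradient step of length `1 / L`. -/
lemma projected_gradient_step_le {K : Set H} (hK : Convex ℝ K) {h : H → ℝ}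
    (hconv : ConvexOn ℝ Set.univ h) {g : H → H} (hgrad : ∀ x, HasGradientAt h (g x) x)
    {L : ℝ} (hL : 0 < L) (hLip : ∀ x y, ‖g x - g y‖ ≤ L * ‖x - y‖) {y p : H} (hp : p ∈ K)
    (hmin : ∀ z ∈ K, ‖y - (1 / L) • g y - p‖ ≤ ‖y - (1 / L) • g y - z‖) {z : H} (hz : z ∈ K) :
    2 / L * (h p - h z) + ‖p - z‖ ^ 2 ≤ ‖y - z‖ ^ 2 := by
  have hvi := hK.inner_sub_le_zero_of_forall_norm_le hp hmin hz
  have hdesc := le_add_inner_add_of_lipschitz_gradient hgrad hLip y p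
  have hsub := hconv.add_inner_le_of_hasGradientAt (hgrad y) z
  have hvi' : L * ⟪y - p, z - p⟫ ≤ ⟪g y, z - p⟫ := by
    rw [sub_right_comm, inner_sub_left, real_inner_smul_left] at hvi
    have := mul_le_mul_of_nonneg_left hvi hL.le
    field_simp at this
    linarith
  have hinner : ⟪g y, z - p⟫ = ⟪g y, z - y⟫ - ⟪g y, p - y⟫ := by
    rw [← inner_sub_right, sub_sub_sub_cancel_right]
  have hnorm : ‖y - z‖ ^ 2 = ‖p - y‖ ^ 2 - 2 * ⟪y - p, z - p⟫ + ‖p - z‖ ^ 2 := by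
    rw [norm_sub_rev p y, norm_sub_rev p z, ← norm_sub_sq_real, sub_sub_sub_cancel_right]
  have hmain : h p - h z ≤ L / 2 * (‖p - y‖ ^ 2 - 2 * ⟪y - p, z - p⟫) := by linarith
  have := mul_le_mul_of_nonneg_left hmain (by positivity : 0 ≤ 2 / L)
  rw [← mul_assoc, show 2 / L * (L / 2) = 1 by field_simp, one_mul] at this
  linarith

end Hilbert


/-- AFBS iterates converge weakly to a minimizer of `h` over `K`. -/
theorem afbs_weak_convergence_iterates
    {H : Type*} [NormedAddCommGroup H] [InnerProductSpace ℝ H] [CompleteSpace H]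
    (K : Set H) (hKne : K.Nonempty) (hKcl : IsClosed K) (hKcv : Convex ℝ K)
    (h : H → ℝ) (hconv : ConvexOn ℝ Set.univ h)
    (g : H → H) (hgrad : ∀ x, HasGradientAt h (g x) x)
    (L : ℝ) (hL : 0 < L) (hLip : ∀ x y, ‖g x - g y‖ ≤ L * ‖x - y‖)
    (P : H → H)
    (hPmem : ∀ y, P y ∈ K)
    (hPmin : ∀ y, ∀ z ∈ K, ‖y - P y‖ ≤ ‖y - z‖)
    (a : ℝ) (ha : 2 < a)
    (lam lamhat : ℕ → H)
    (hhat0 : lamhat 0 = lam 0)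
    (hhat : ∀ k : ℕ, 1 ≤ k →
      lamhat k = lam k + (((k : ℝ) - 1) / ((k : ℝ) + a)) • (lam k - lam (k - 1)))
    (hupd : ∀ k : ℕ, lam (k + 1) = P (lamhat k - (1 / L) • g (lamhat k)))
    (hattain : ∃ m ∈ K, ∀ z ∈ K, h m ≤ h z) :
    ∃ laminf ∈ K, (∀ z ∈ K, h laminf ≤ h z) ∧
      ∀ y : H, Filter.Tendsto (fun k : ℕ => ⟪lam k, y⟫) Filter.atTop (nhds ⟪laminf, y⟫) := by
  obtain ⟨m, hm, hmmin⟩ := hattain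
  have hmem : ∀ n, lam (n + 1) ∈ K := fun n => by rw [hupd]; exact hPmem _
  have hpos : ∀ n : ℕ, 0 < (n : ℝ) + 1 + a := fun n => by positivity
  have hfac : ∀ n : ℕ, 0 ≤ (n : ℝ) / ((n : ℝ) + 1 + a) ∧ (n : ℝ) / ((n : ℝ) + 1 + a) ≤ 1 :=
    fun n => ⟨div_nonneg n.cast_nonneg (hpos n).le, (div_le_one (hpos n)).2 (by linarith)⟩
  have hy : ∀ n : ℕ, lamhat (n + 1) =
      lam (n + 1) + ((n : ℝ) / ((n : ℝ) + 1 + a)) • (lam (n + 1) - lam n) := by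
    intro n
    have := hhat (n + 1) (by omega)
    simpa using this
  have hkey : ∀ n, ∀ z ∈ K, 2 / L * (h (lam (n + 2)) - h z) + ‖lam (n + 2) - z‖ ^ 2 ≤
      ‖lamhat (n + 1) - z‖ ^ 2 := by
    intro n z hz
    refine projected_gradient_step_le hKcv hconv hgrad hL hLip (hmem (n + 1)) ?_ hz
    rw [hupd (n + 1)]
    exact hPmin _
  let φ : ℕ → ℝ := fun n => 2 / L * (h (lam (n + 1)) - h m)
  let d : ℕ → ℝ := fun n => ‖lam (n + 1) - lam n‖ ^ 2
  have hφ : ∀ n, 0 ≤ φ n :=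
    fun n => mul_nonneg (by positivity) (sub_nonneg.2 (hmmin _ (hmem n)))
  have hd : ∀ n, 0 ≤ d n := fun n => sq_nonneg _
  have hφsum : Summable fun n : ℕ => ((n : ℝ) + 1 + a) * φ n := by
    refine summable_mul_of_lyapunov_step ha hφ
      (U := fun n => ‖a • (lam n - m) + ((n : ℝ) + a) • (lam (n + 1) - lam n)‖ ^ 2)
      (fun n => sq_nonneg _) fun n => ?_
    have hb := hpos n
    have hn : (0 : ℝ) ≤ n := n.cast_nonneg
    set b : ℝ := (n : ℝ) + 1 + a with hbdef
    have hw0 : 0 ≤ a / b := div_nonneg (by linarith) hb.le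
    have hw1 : 0 ≤ 1 - a / b := sub_nonneg.2 ((div_le_one hb).2 (by linarith))
    have hz := hKcv (hmem n) hm hw1 hw0 (by ring)
    have hcz := hconv.2 (Set.mem_univ (lam (n + 1))) (Set.mem_univ m) hw1 hw0 (by ring)
    have hk := hkey n _ hz
    set z := (1 - a / b) • lam (n + 1) + (a / b) • m with hzdef
    have h1 : a • (lam n - m) + ((n : ℝ) + a) • (lam (n + 1) - lam n) =
        b • (lamhat (n + 1) - z) := by
      rw [hy, hzdef]
      match_scalars <;> field_simp <;> ring
    have h2 : a • (lam (n + 1) - m) + (((n + 1 : ℕ) : ℝ) + a) • (lam (n + 2) - lam (n + 1)) =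
        b • (lam (n + 2) - z) := by
      rw [hzdef]
      push_cast
      match_scalars <;> field_simp <;> ring
    have h3 : 2 / L * (h (lam (n + 2)) - h z) ≥ φ (n + 1) - (1 - a / b) * φ n := by
      have : h (lam (n + 2)) - h z ≥
          (h (lam (n + 2)) - h m) - (1 - a / b) * (h (lam (n + 1)) - h m) := by
        simp only [smul_eq_mul] at hcz
        linarith
      refine le_trans (le_of_eq ?_) (mul_le_mul_of_nonneg_left this (by positivity))
      simp only [φ]
      ring
    have h4 : φ (n + 1) + ‖lam (n + 2) - z‖ ^ 2 ≤
        (1 - a / b) * φ n + ‖lamhat (n + 1) - z‖ ^ 2 := by linarith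
    have h5 := mul_le_mul_of_nonneg_left h4 (sq_nonneg b)
    rw [h1, h2, norm_smul, norm_smul, mul_pow, mul_pow, Real.norm_eq_abs, sq_abs]
    have h6 : b ^ 2 * ((1 - a / b) * φ n) = (b ^ 2 - a * b) * φ n := by
      field_simp
    linarith
  have hdsum : Summable fun n : ℕ => ((n : ℝ) + 1 + a) * d n := by
    refine summable_mul_of_energy_step ha hφ hd (fun n => ?_) hφsum
    have hk := hkey n _ (hmem n)
    rw [hy, add_sub_cancel_left, norm_smul, mul_pow, Real.norm_eq_abs, sq_abs] at hk
    simp only [φ, d]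
    linarith
  have hdist : ∀ q ∈ {q ∈ K | ∀ z ∈ K, h q ≤ h z},
      ∃ l, Tendsto (fun n => ‖lam n - q‖ ^ 2) atTop (𝓝 l) := by
    rintro q ⟨hq, hqmin⟩
    refine exists_tendsto_of_inertial_step ha (fun n => sq_nonneg _) hd (fun n => ?_) hdsum
    have hk := hkey n q hq
    have hnn : 0 ≤ 2 / L * (h (lam (n + 2)) - h q) :=
      mul_nonneg (by positivity) (sub_nonneg.2 (hqmin _ (hmem (n + 1))))
    obtain ⟨hα0, hα1⟩ := hfac n
    have hyq := hy n
    set α : ℝ := (n : ℝ) / ((n : ℝ) + 1 + a)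
    have hid : ‖lamhat (n + 1) - q‖ ^ 2 = ‖lam (n + 1) - q‖ ^ 2 +
        α * (‖lam (n + 1) - q‖ ^ 2 - ‖lam n - q‖ ^ 2) + α * (1 + α) * d n := by
      have e1 : lamhat (n + 1) - q =
          (lam (n + 1) - q) + α • (lam (n + 1) - lam n) := by rw [hyq]; abel
      have e2 : lam n - q = (lam (n + 1) - q) - (lam (n + 1) - lam n) := by abel
      rw [e1, e2, norm_add_sq_real, norm_sub_sq_real (lam (n + 1) - q), norm_smul, mul_pow, Real.norm_eq_abs,
        sq_abs, real_inner_smul_right]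
      simp only [d]
      ring
    have hα : α * (1 + α) * d n ≤ 2 * d n :=
      mul_le_mul_of_nonneg_right (by nlinarith) (hd n)
    linarith
  have hval : Tendsto (fun n => h (lam n)) atTop (𝓝 (h m)) := by
    have hφ0 : Tendsto φ atTop (𝓝 0) := by
      refine (Summable.of_nonneg_of_le hφ (fun n => ?_) hφsum).tendsto_atTop_zero
      exact le_mul_of_one_le_left (hφ n) (by linarith [(n.cast_nonneg : (0 : ℝ) ≤ n)])
    refine (tendsto_add_atTop_iff_nat 1).1 ?_
    have := (hφ0.const_mul (L / 2)).add_const (h m)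
    rw [mul_zero, zero_add] at this
    refine this.congr fun n => ?_
    simp only [φ]
    field_simp
    ring
  obtain ⟨p, ⟨hpK, hpmin⟩, hp⟩ := exists_tendsto_inner_of_tendsto_norm_sub_sq
    (S := {q ∈ K | ∀ z ∈ K, h q ≤ h z}) ⟨m, hm, hmmin⟩ hdist fun U hU p hp => by
      have hp' : ∀ q y, Tendsto (fun n => ⟪y, lam n - q⟫) U (𝓝 ⟪y, p - q⟫) := by
        intro q y
        simp only [real_inner_comm _ y, inner_sub_left]
        exact (hp y).sub_const _
      have hpP : p = P p := by
        have hle : ⟪p - P p, p - P p⟫ ≤ 0 := by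
          refine le_of_tendsto (hp' (P p) (p - P p)) (hU ?_)
          filter_upwards [eventually_ge_atTop 1] with n hn
          obtain ⟨k, rfl⟩ := Nat.exists_eq_add_of_le' hn
          exact hKcv.inner_sub_le_zero_of_forall_norm_le (hPmem p) (hPmin p) (hmem k)
        exact sub_eq_zero.1 (real_inner_self_nonpos.1 hle)
      refine ⟨hpP ▸ hPmem p, fun z hz => le_trans ?_ (hmmin z hz)⟩
      have hlim := (hp' p (g p)).const_add (h p)
      rw [sub_self, inner_zero_right, add_zero] at hlim
      exact le_of_tendsto_of_tendsto' hlim (hval.mono_left hU)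
        fun n => hconv.add_inner_le_of_hasGradientAt (hgrad p) (lam n)
  exact ⟨p, hpK, hpmin, hp⟩
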